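/- Fix an integer L ≥ 1, a real r ∈ (0,1), an integer M ≥ 1, and nonnegative reals p_0,...,p_M with Σ_{j=0}^{M} p_j = 1, and assume L·r > Σ_{j=0}^{M} j·p_j. Then for every threshold t ∈ ℕ, the threshold-policy transition kernel P_t on ℕ admits an invariant probability distribution: there exists v : ℕ → ℝ with v(y) ≥ 0 for all y, Σ_{y=0}^{∞} v(y) = 1, and v(y) = Σ_{x=0}^{∞} v(x)·P_t(x,y) for every y ∈ ℕ. -/

import Mathlib

/-- The transition kernel on ℕ of the queue under the threshold admission
policy with threshold `t`: arrivals are admitted exactly when the current state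
is at most `t`.  ℕ-subtraction `x - d` realizes `max(x − d, 0)`. -/
noncomputable def thresholdKernel (L M : ℕ) (r : ℝ) (p : ℕ → ℝ) (t x y : ℕ) : ℝ :=
  ∑ d ∈ Finset.range (L + 1), ∑ j ∈ Finset.range (M + 1),
    ((L.choose d : ℝ) * r ^ d * (1 - r) ^ (L - d)) * p j *
      (if y = (x - d) + (if x ≤ t then j else 0) then 1 else 0)

/-- A finite row-stochastic real matrix has an invariant probability vector. -/
theorem Matrix.exists_invariant_probability {ι : Type*} [Fintype ι] [DecidableEq ι] [Nonempty ι]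
    (A : Matrix ι ι ℝ) (hA : ∀ i j, 0 ≤ A i j) (hA1 : ∀ i, ∑ j, A i j = 1) :
    ∃ v : ι → ℝ, (∀ i, 0 ≤ v i) ∧ ∑ i, v i = 1 ∧ ∀ j, v j = ∑ i, v i * A i j := by
  have hdet : (A - 1).det = 0 := by
    rw [← Matrix.exists_mulVec_eq_zero_iff]
    refine ⟨fun _ => 1, fun h => one_ne_zero (congrFun h (Classical.arbitrary ι)), ?_⟩
    ext i
    simp [Matrix.mulVec, dotProduct, hA1, Matrix.one_apply]
  obtain ⟨w, hw0, hw⟩ := Matrix.exists_vecMul_eq_zero_iff.mpr hdet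
  rw [Matrix.vecMul_sub, Matrix.vecMul_one, sub_eq_zero] at hw
  have hle : ∀ j, |w j| ≤ ∑ i, |w i| * A i j := fun j => by
    calc |w j| = |∑ i, w i * A i j| := congrArg abs (congrFun hw j).symm
      _ ≤ ∑ i, |w i * A i j| := Finset.abs_sum_le_sum_abs _ _
      _ = ∑ i, |w i| * A i j := by simp [abs_mul, abs_of_nonneg (hA _ _)]
  have hsum : ∑ j, |w j| = ∑ j, ∑ i, |w i| * A i j := by
    rw [Finset.sum_comm]
    simp [← Finset.mul_sum, hA1]
  have heq := (Finset.sum_eq_sum_iff_of_le fun j _ => hle j).mp hsum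
  have hpos : 0 < ∑ i, |w i| := by
    obtain ⟨i, hi⟩ := Function.ne_iff.mp hw0
    exact Finset.sum_pos' (fun _ _ => abs_nonneg _) ⟨i, Finset.mem_univ i, abs_pos.mpr hi⟩
  refine ⟨fun i => |w i| / ∑ k, |w k|, fun i => by positivity, ?_, fun j => ?_⟩
  · rw [← Finset.sum_div, div_self hpos.ne']
  · simp only [div_mul_eq_mul_div]
    rw [← Finset.sum_div, ← heq j (Finset.mem_univ j)]

theorem thresholdKernel_nonneg {L M : ℕ} {r : ℝ} {p : ℕ → ℝ} (hr0 : 0 ≤ r) (hr1 : r ≤ 1)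
    (hp : ∀ j, 0 ≤ p j) (t x y : ℕ) : 0 ≤ thresholdKernel L M r p t x y := by
  have := sub_nonneg.mpr hr1
  refine Finset.sum_nonneg fun d _ => Finset.sum_nonneg fun j _ => ?_
  have := hp j
  split_ifs <;> positivity

/-- The states `0, …, t + M` form a closed set for the threshold kernel. -/
theorem thresholdKernel_eq_zero {L M : ℕ} {r : ℝ} {p : ℕ → ℝ} {t x y : ℕ}
    (hx : x < t + M + 1) (hy : t + M + 1 ≤ y) : thresholdKernel L M r p t x y = 0 := by
  refine Finset.sum_eq_zero fun d _ => Finset.sum_eq_zero fun j hj => ?_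
  have := Finset.mem_range.mp hj
  rw [if_neg (by split_ifs <;> omega), mul_zero]

theorem sum_thresholdKernel {L M : ℕ} {r : ℝ} {p : ℕ → ℝ}
    (hpsum : ∑ j ∈ Finset.range (M + 1), p j = 1) {t x : ℕ} (hx : x < t + M + 1) :
    ∑ y ∈ Finset.range (t + M + 1), thresholdKernel L M r p t x y = 1 := by
  unfold thresholdKernel
  rw [Finset.sum_comm]
  calc _ = ∑ d ∈ Finset.range (L + 1), (L.choose d : ℝ) * r ^ d * (1 - r) ^ (L - d) := by
        refine Finset.sum_congr rfl fun d _ => ?_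
        rw [Finset.sum_comm]
        refine Eq.trans ?_ ((congrArg (_ * ·) hpsum).trans (mul_one _))
        rw [Finset.mul_sum]
        refine Finset.sum_congr rfl fun j hj => ?_
        have := Finset.mem_range.mp hj
        rw [← Finset.mul_sum, Finset.sum_ite_eq' (Finset.range (t + M + 1)),
          if_pos (Finset.mem_range.mpr (by split_ifs <;> omega)), mul_one]
    _ = (r + (1 - r)) ^ L := by
        rw [add_pow]
        exact Finset.sum_congr rfl fun d _ => by ring
    _ = 1 := by simp

/-- under the stability condition `L·r > Σ_j j·p_j`, for every
threshold `t` the threshold-policy chain admits an invariant probability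
distribution. -/
theorem stmt_16 (L M : ℕ) (hL : 1 ≤ L) (hM : 1 ≤ M)
    (r : ℝ) (hr0 : 0 < r) (hr1 : r < 1)
    (p : ℕ → ℝ) (hp : ∀ j, 0 ≤ p j)
    (hpsum : ∑ j ∈ Finset.range (M + 1), p j = 1)
    (hstab : (L : ℝ) * r > ∑ j ∈ Finset.range (M + 1), (j : ℝ) * p j) :
    ∀ t : ℕ, ∃ v : ℕ → ℝ,
      (∀ y, 0 ≤ v y) ∧ (∑' y : ℕ, v y) = 1 ∧
      ∀ y : ℕ, v y = ∑' x : ℕ, v x * thresholdKernel L M r p t x y := by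
  intro t
  obtain ⟨v, hv0, hv1, hv⟩ := Matrix.exists_invariant_probability
    (Matrix.of fun x y : Fin (t + M + 1) => thresholdKernel L M r p t x y)
    (fun x y => thresholdKernel_nonneg hr0.le hr1.le hp t x y)
    (fun x => by
      simpa [Finset.sum_range] using sum_thresholdKernel (L := L) (r := r) hpsum x.isLt)
  have hsupp : ∀ f : ℕ → ℝ,
      ∑' x : ℕ, (if h : x < t + M + 1 then v ⟨x, h⟩ else 0) * f x = ∑ i, v i * f i := fun f => by
    rw [tsum_eq_sum (s := Finset.range (t + M + 1)) fun x hx => by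
      rw [dif_neg (by simpa using hx), zero_mul], Finset.sum_range]
    exact Finset.sum_congr rfl fun x _ => by rw [dif_pos x.isLt]
  refine ⟨fun x => if h : x < t + M + 1 then v ⟨x, h⟩ else 0, fun y => ?_, ?_, fun y => ?_⟩
  · dsimp only
    split_ifs
    exacts [hv0 _, le_rfl]
  · simpa [hv1] using hsupp fun _ => 1
  · rw [hsupp fun x => thresholdKernel L M r p t x y]
    dsimp only
    split_ifs with h
    · exact hv ⟨y, h⟩
    · exact (Finset.sum_eq_zero fun x _ => by
        rw [thresholdKernel_eq_zero x.isLt (not_lt.mp h), mul_zero]).symm
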